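/- Assume Setup (T). Then P ∗ (p^m · a) = 0 for every a ∈ A. -/

import Mathlib

/-- A (left) brace: an abelian group `(A,+)` and a group `(A,∘)` (written `*`)
on the same underlying set, with `a∘(b+c)+a = a∘b+a∘c`; the identity of `(A,∘)`
coincides with `0`. -/
class Brace (A : Type*) extends AddCommGroup A, Group A where
  mul_add_left : ∀ a b c : A, a * (b + c) + a = a * b + a * c
  one_eq_zero : (1 : A) = 0

namespace Brace

variable {A : Type*} [Brace A]

/-- The star operation `a ∗ b = a∘b - a - b`. -/
def bstar (a b : A) : A := a * b - a - b

/-- `X ∗ Y`: the additive subgroup generated by `{x∗y : x ∈ X, y ∈ Y}`. -/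
def starSpan (A : Type*) [Brace A] (X Y : Set A) : AddSubgroup A :=
  AddSubgroup.closure {z : A | ∃ x ∈ X, ∃ y ∈ Y, z = bstar x y}

/-- `A² = A ∗ A`. -/
def sq (A : Type*) [Brace A] : AddSubgroup A := starSpan A Set.univ Set.univ

/-- `A³ = A ∗ A²`. -/
def cube (A : Type*) [Brace A] : AddSubgroup A := starSpan A Set.univ (sq A : Set A)

/-- The right series: `rightSeries A 0 = A^(1) = A`, `rightSeries A (n+1) = A^(n+1+1) = A^(n+1) ∗ A`. -/
def rightSeries (A : Type*) [Brace A] : ℕ → AddSubgroup A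
  | 0 => ⊤
  | n + 1 => starSpan A (rightSeries A n : Set A) Set.univ

/-- A brace is right nilpotent if `A^(n) = 0` for some `n`. -/
def RightNilpotent (A : Type*) [Brace A] : Prop := ∃ n : ℕ, rightSeries A n = ⊥

/-- `c ∈ Z(A)`: `c∗a = a∗c` for all `a`. -/
def IsCentral (c : A) : Prop := ∀ a : A, bstar c a = bstar a c

end Brace

/-- Setup (T) of the paper: `p > 5` prime, `A` a brace of cardinality `p^4` whose additive
group is `C_p × C_{p^3}` (with `m = 2`) or `C_{p^2} × C_{p^2}` (with `m = 1`), whose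
multiplicative group is generated by `{P, Q_1, …, Q_i}`, with `P^{p^m}` central and in `A²`,
each `Q_j` of order at most `p^m`, and every `a ∈ A` writable as
`P^k ∘ Q_{σ(1)}^{a_{σ(1)}} ∘ ⋯ ∘ Q_{σ(i)}^{a_{σ(i)}}` for every ordering `σ`. -/
structure SetupT (p m i : ℕ) (A : Type*) [Brace A] (P : A) (Q : Fin i → A) : Prop where
  hp : p.Prime
  hp5 : 5 < p
  hcard : Nat.card A = p ^ 4
  hadd : (Nonempty (A ≃+ ZMod p × ZMod (p ^ 3)) ∧ m = 2) ∨
         (Nonempty (A ≃+ ZMod (p ^ 2) × ZMod (p ^ 2)) ∧ m = 1)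
  hgen : Subgroup.closure ({P} ∪ Set.range Q) = ⊤
  hcentral : Brace.IsCentral (P ^ (p ^ m))
  hsq : P ^ (p ^ m) ∈ Brace.sq A
  hord : ∀ j : Fin i, orderOf (Q j) ≤ p ^ m
  hdecomp : ∀ a : A, ∀ σ : Equiv.Perm (Fin i), ∃ (k : ℤ) (e : Fin i → ℤ),
      a = P ^ k * (List.ofFn fun t : Fin i => Q (σ t) ^ e (σ t)).prod

namespace Brace

variable {A : Type*} [Brace A]

/-- The additive endomorphism `b ↦ a∘b - a`. -/
def lam (a : A) : AddMonoid.End A :=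
  AddMonoidHom.mk' (fun b => a * b - a) fun b c => by
    have h := mul_add_left a b c
    rw [eq_sub_of_add_eq h]
    abel

theorem lam_apply (a b : A) : lam a b = a * b - a := rfl

theorem mul_eq_add_lam (a b : A) : a * b = a + lam a b := by
  rw [lam_apply]; abel

theorem lam_one (b : A) : lam 1 b = b := by
  rw [lam_apply, one_mul, one_eq_zero, sub_zero]

theorem lam_mul (a b c : A) : lam (a * b) c = lam a (lam b c) := by
  have h : a * b + lam (a * b) c = a * b + lam a (lam b c) := by
    rw [← mul_eq_add_lam, mul_assoc, mul_eq_add_lam b c, mul_eq_add_lam a (b + lam b c), map_add,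
      mul_eq_add_lam a b, add_assoc]
  exact add_left_cancel h

theorem bstar_eq_lam_sub (a b : A) : bstar a b = lam a b - b := rfl

theorem pow_eq_sum_lam (a : A) (n : ℕ) :
    a ^ n = (∑ k ∈ Finset.range n, lam a ^ k) a := by
  induction n with
  | zero => simp [one_eq_zero]
  | succ n ih =>
    rw [pow_succ', mul_eq_add_lam, ih, Finset.sum_range_succ']
    simp only [pow_succ', ← Finset.mul_sum]
    exact add_comm _ _

/-- The elements on which every `λ_a` acts trivially modulo `H`. -/
def fixedMod (H : AddSubgroup A) : AddSubgroup A where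
  carrier := {x | ∀ a : A, lam a x - x ∈ H}
  zero_mem' a := by simp
  add_mem' {x y} hx hy a := by
    have := H.add_mem (hx a) (hy a)
    rwa [map_add, add_sub_add_comm]
  neg_mem' {x} hx a := by
    have := H.neg_mem (hx a)
    rwa [neg_sub', ← map_neg] at this

theorem lam_mem_fixedMod {H : AddSubgroup A} (a : A) {x : A} (hx : x ∈ fixedMod H) :
    lam a x ∈ fixedMod H := fun b => by
  have := H.sub_mem (hx (b * a)) (hx a)
  rwa [lam_mul, sub_sub_sub_cancel_right] at this

/-- In a brace of prime power order, a proper left ideal is properly contained in the subgroup of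
elements fixed modulo it. -/
theorem lt_fixedMod {p n : ℕ} (hp : p.Prime) (hcard : Nat.card A = p ^ n) {H : AddSubgroup A}
    (hH : ∀ a : A, ∀ x ∈ H, lam a x ∈ H) (hne : H ≠ ⊤) : H < fixedMod H := by
  have : Fact p.Prime := ⟨hp⟩
  have : Finite A := Nat.finite_of_card_ne_zero (by rw [hcard]; exact pow_ne_zero _ hp.ne_zero)
  let act : MulAction A (A ⧸ H) :=
    { smul := fun a => QuotientAddGroup.map H H (lam a) (hH a)
      one_smul := by
        rintro ⟨x⟩
        exact congrArg (QuotientAddGroup.mk (s := H)) (lam_one x)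
      mul_smul := by
        rintro a b ⟨x⟩
        exact congrArg (QuotientAddGroup.mk (s := H)) (lam_mul a b x) }
  have hsmul : ∀ (a x : A), a • (x : A ⧸ H) = ((lam a x : A) : A ⧸ H) := fun _ _ => rfl
  have hdvd : p ∣ Nat.card (A ⧸ H) := by
    have h1 : H.index ∣ p ^ n := hcard ▸ H.index_dvd_card
    obtain ⟨k, -, hk⟩ := (Nat.dvd_prime_pow hp).1 h1
    have hk0 : k ≠ 0 := by
      rintro rfl
      exact hne (AddSubgroup.index_eq_one.1 (by simpa using hk))
    change p ∣ H.index
    rw [hk]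
    exact dvd_pow_self p hk0
  have hfix : ((0 : A) : A ⧸ H) ∈ MulAction.fixedPoints A (A ⧸ H) := fun a => by
    rw [hsmul, map_zero]
  obtain ⟨b, hb, hb0⟩ := (IsPGroup.of_card hcard).exists_fixed_point_of_prime_dvd_card_of_fixed_point
    (A ⧸ H) hdvd hfix
  obtain ⟨x, rfl⟩ := QuotientAddGroup.mk_surjective b
  refine lt_of_le_of_ne (fun y hy a => H.sub_mem (hH a y hy) hy) fun heq => hb0 ?_
  have hx : x ∈ fixedMod H := fun a => by
    have h1 := hb a
    rw [hsmul, eq_comm, QuotientAddGroup.eq] at h1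
    rwa [neg_add_eq_sub] at h1
  rw [← heq] at hx
  rw [QuotientAddGroup.mk_zero, eq_comm]
  exact (QuotientAddGroup.eq_zero_iff x).2 hx

end Brace

theorem AddSubgroup.eq_top_of_lt_of_index_eq_prime {G : Type*} [AddGroup G] {p : ℕ} (hp : p.Prime)
    {H K : AddSubgroup G} (hHK : H < K) (hi : H.index = p) : K = ⊤ := by
  have hmul := AddSubgroup.relIndex_mul_index hHK.le
  rw [hi] at hmul
  rcases (Nat.dvd_prime hp).1 (Dvd.intro_left _ hmul) with h | h
  · exact AddSubgroup.index_eq_one.1 h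
  · rw [h] at hmul
    have h1 : H.relIndex K = 1 := Nat.eq_of_mul_eq_mul_right hp.pos (by rw [hmul, one_mul])
    exact absurd (AddSubgroup.relIndex_eq_one.1 h1) hHK.not_ge

theorem AddSubgroup.eq_top_of_lt_of_lt_of_index_eq_prime_sq {G : Type*} [AddGroup G] {p : ℕ}
    (hp : p.Prime) {H K L : AddSubgroup G} (hHK : H < K) (hKL : K < L) (hi : H.index = p ^ 2) :
    L = ⊤ := by
  have hmul := AddSubgroup.relIndex_mul_index hHK.le
  rw [hi] at hmul
  obtain ⟨k, hk, hk'⟩ := (Nat.dvd_prime_pow hp).1 (Dvd.intro_left _ hmul)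
  interval_cases k
  · have : K = ⊤ := AddSubgroup.index_eq_one.1 (by simpa using hk')
    exact absurd le_top (this ▸ hKL).not_ge
  · exact eq_top_of_lt_of_index_eq_prime hp hKL (by simpa using hk')
  · rw [hk'] at hmul
    have h1 : H.relIndex K = 1 :=
      Nat.eq_of_mul_eq_mul_right (pow_pos hp.pos 2) (by rw [hmul, one_mul])
    exact absurd (AddSubgroup.relIndex_eq_one.1 h1) hHK.not_ge

theorem geom_sum_one_add_of_pow_four_eq_zero {R : Type*} [Ring R] {N : R} (hN : N ^ 4 = 0) (n : ℕ) :
    (1 + N) ^ n = 1 + n * N + n.choose 2 * N ^ 2 + n.choose 3 * N ^ 3 ∧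
    ∑ k ∈ Finset.range n, (1 + N) ^ k =
      n + n.choose 2 * N + n.choose 3 * N ^ 2 + n.choose 4 * N ^ 3 := by
  induction n with
  | zero => simp
  | succ n ih =>
    have e2 : (n + 1).choose 2 = n + n.choose 2 := by simp [Nat.choose_succ_succ' n 1]
    have e3 : (n + 1).choose 3 = n.choose 2 + n.choose 3 := Nat.choose_succ_succ' n 2
    have e4 : (n + 1).choose 4 = n.choose 3 + n.choose 4 := Nat.choose_succ_succ' n 3
    constructor
    · rw [pow_succ, ih.1, e2, e3]
      have : (n.choose 3 : R) * N ^ 3 * N = 0 := by rw [mul_assoc, ← pow_succ, hN, mul_zero]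
      push_cast
      rw [mul_add, mul_one, add_mul _ _ N, this]
      noncomm_ring
    · rw [Finset.sum_range_succ, ih.1, ih.2, e2, e3, e4]
      push_cast
      noncomm_ring

theorem geom_sum_one_add_prime {R : Type*} [Ring R] {N : R} {p : ℕ} (hp : p.Prime) (hp5 : 5 < p)
    (hN : N ^ 4 = 0) (hpN : (p : R) * N ^ 2 = 0) :
    ∑ k ∈ Finset.range p, (1 + N) ^ k = p + p.choose 2 * N := by
  rw [(geom_sum_one_add_of_pow_four_eq_zero hN p).2]
  obtain ⟨a, ha⟩ := hp.dvd_choose_self (k := 3) (by norm_num) (by omega)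
  obtain ⟨b, hb⟩ := hp.dvd_choose_self (k := 4) (by norm_num) (by omega)
  have h3 : (p.choose 3 : R) * N ^ 2 = 0 := by
    rw [ha, mul_comm, Nat.cast_mul, mul_assoc, hpN, mul_zero]
  have h4 : (p.choose 4 : R) * N ^ 3 = 0 := by
    rw [hb, mul_comm, Nat.cast_mul, mul_assoc, pow_succ, ← mul_assoc (p : R), hpN, zero_mul, mul_zero]
  rw [h3, h4, add_zero, add_zero]

namespace Brace

variable {A : Type*} [Brace A]

/-- If the additive `q`-torsion has index `p`, then every `λ_a` acts trivially on `q • A`. -/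
theorem nsmul_bstar_eq_zero_of_index {p n q : ℕ} (hp : p.Prime) (hcard : Nat.card A = p ^ n)
    (hi : (nsmulAddMonoidHom (α := A) q).ker.index = p) (a x : A) : bstar a (q • x) = 0 := by
  set H := (nsmulAddMonoidHom (α := A) q).ker
  have hmem : ∀ x, x ∈ H ↔ q • x = 0 := fun _ => Iff.rfl
  have hne : H ≠ ⊤ := fun h => hp.one_lt.ne (by rw [← hi, h, AddSubgroup.index_top])
  have hlt := lt_fixedMod hp hcard (H := H)
    (fun a x hx => by rw [hmem] at *; rw [← map_nsmul, hx, map_zero]) hne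
  have hx : x ∈ fixedMod H :=
    AddSubgroup.eq_top_of_lt_of_index_eq_prime hp hlt hi ▸ AddSubgroup.mem_top x
  rw [bstar_eq_lam_sub, map_nsmul, ← nsmul_sub]
  exact hx a

theorem nsmul_lam_sub_one_sq {p n : ℕ} (hp : p.Prime) (hcard : Nat.card A = p ^ n)
    (hi : (nsmulAddMonoidHom (α := A) p).ker.index = p ^ 2) (a x : A) :
    p • ((lam a - 1) ((lam a - 1) x)) = 0 := by
  set H := (nsmulAddMonoidHom (α := A) p).ker
  have hmem : ∀ x, x ∈ H ↔ p • x = 0 := fun _ => Iff.rfl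
  have hne : H ≠ ⊤ := fun h =>
    (Nat.one_lt_pow two_ne_zero hp.one_lt).ne (by rw [← hi, h, AddSubgroup.index_top])
  have hlt := lt_fixedMod hp hcard (H := H)
    (fun a x hx => by rw [hmem] at *; rw [← map_nsmul, hx, map_zero]) hne
  have htop : fixedMod (fixedMod H) = ⊤ := by
    by_cases h : fixedMod H = ⊤
    · rw [h, eq_top_iff]
      exact fun _ _ _ => AddSubgroup.mem_top _
    · exact AddSubgroup.eq_top_of_lt_of_lt_of_index_eq_prime_sq hp hlt
        (lt_fixedMod hp hcard (fun a x hx => lam_mem_fixedMod a hx) h) hi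
  have hx : x ∈ fixedMod (fixedMod H) := htop ▸ AddSubgroup.mem_top x
  exact hx a a

theorem index_ker_nsmul {p : ℕ} (hcard : Nat.card A = p ^ 4)
    (htor : ∀ x : A, p • x = 0 ↔ ∃ y, x = p • y) :
    (nsmulAddMonoidHom (α := A) p).ker.index = p ^ 2 := by
  have hr : (nsmulAddMonoidHom (α := A) p).ker = (nsmulAddMonoidHom (α := A) p).range := by
    ext x
    rw [AddMonoidHom.mem_ker, AddMonoidHom.mem_range]
    simp only [nsmulAddMonoidHom_apply, htor x, eq_comm]
  have h1 := (nsmulAddMonoidHom (α := A) p).ker.card_mul_index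
  have h2 := AddSubgroup.index_ker (nsmulAddMonoidHom (α := A) p)
  rw [← hr] at h2
  rw [← h2, hcard, ← pow_two, show 4 = 2 * 2 from rfl, pow_mul] at h1
  exact Nat.pow_left_injective (n := 2) two_ne_zero h1

theorem pow_prime_eq {p : ℕ} (hp : p.Prime) (hp5 : 5 < p) (hcard : Nat.card A = p ^ 4)
    (htor : ∀ x : A, p • x = 0 ↔ ∃ y, x = p • y) (a : A) :
    a ^ p = p • a + p.choose 2 • (lam a - 1) a := by
  have hsq := nsmul_lam_sub_one_sq hp hcard (index_ker_nsmul hcard htor) a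
  set N : AddMonoid.End A := lam a - 1 with hNdef
  have hpN : (p : AddMonoid.End A) * N ^ 2 = 0 := by
    ext x
    rw [pow_two]
    exact hsq x
  have hN : N ^ 4 = 0 := by
    ext x
    obtain ⟨y, hy⟩ := (htor _).1 (hsq x)
    have h4 : (N ^ 4) x = N (N (N (N x))) := rfl
    rw [h4, hy, map_nsmul, map_nsmul, hsq]
    rfl
  have := geom_sum_one_add_prime hp hp5 hN hpN
  rw [hNdef, add_sub_cancel] at this
  rw [pow_eq_sum_lam, this]
  rfl

theorem nsmul_eq_zero_of_pow_eq_one {p : ℕ} (hp : p.Prime) (hp5 : 5 < p) (hcard : Nat.card A = p ^ 4)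
    (htor : ∀ x : A, p • x = 0 ↔ ∃ y, x = p • y) {a : A} (ha : a ^ p = 1) : p • a = 0 := by
  have hsq := nsmul_lam_sub_one_sq hp hcard (index_ker_nsmul hcard htor) a a
  rw [pow_prime_eq hp hp5 hcard htor, one_eq_zero] at ha
  obtain ⟨c, hc⟩ := hp.dvd_choose_self (k := 2) (by norm_num) (by omega)
  have h1 : p • (lam a - 1) a = 0 := by
    have := congrArg (lam a - 1 : AddMonoid.End A) ha
    rw [map_add, map_nsmul, map_nsmul, map_zero, hc, mul_comm, mul_nsmul', hsq, nsmul_zero,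
      add_zero] at this
    exact this
  rwa [hc, mul_comm, mul_nsmul', h1, nsmul_zero, add_zero] at ha

/-- The `n`-torsion of the additive group, as a subgroup of the multiplicative group. -/
def mulTorsion (A : Type*) [Brace A] (n : ℕ) : Subgroup A where
  carrier := {x | n • x = 0}
  one_mem' := by
    change n • (1 : A) = 0
    rw [one_eq_zero, nsmul_zero]
  mul_mem' {x y} hx hy := by
    change n • (x * y) = 0
    rw [mul_eq_add_lam, nsmul_add, show n • x = 0 from hx, ← map_nsmul,
      show n • y = 0 from hy, map_zero, add_zero]
  inv_mem' {x} hx := by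
    have h : x⁻¹ + lam x⁻¹ x = 0 := by rw [← mul_eq_add_lam, inv_mul_cancel, one_eq_zero]
    change n • x⁻¹ = 0
    rw [eq_neg_of_add_eq_zero_left h, neg_nsmul, ← map_nsmul, show n • x = 0 from hx, map_zero,
      neg_zero]

theorem nsmul_mul_of_mem_mulTorsion {n : ℕ} (a : A) {x : A} (hx : x ∈ mulTorsion A n) :
    n • (a * x) = n • a := by
  rw [mul_eq_add_lam, nsmul_add, ← map_nsmul, show n • x = 0 from hx, map_zero, add_zero]

theorem exists_forall_ne_zpow_mul {p : ℕ} (hp : p.Prime) (hp5 : 5 < p) (hcard : Nat.card A = p ^ 4)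
    (htor : ∀ x : A, p • x = 0 ↔ ∃ y, x = p • y) (P : A) :
    ∃ a : A, ∀ k : ℤ, ∀ x ∈ mulTorsion A p, a ≠ P ^ k * x := by
  by_contra! hcon
  have hPp : P ^ p ∈ mulTorsion A p := by
    change p • P ^ p = 0
    obtain ⟨c, hc⟩ := hp.dvd_choose_self (k := 2) (by norm_num) (by omega)
    rw [htor, pow_prime_eq hp hp5 hcard htor, hc, mul_nsmul', ← nsmul_add]
    exact ⟨_, rfl⟩
  have hsub : ((nsmulAddMonoidHom (α := A) p).range : Set A) ⊆
      ((fun k : ℕ => p • P ^ k) '' (Finset.range p : Set ℕ)) := by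
    rintro _ ⟨a, rfl⟩
    obtain ⟨k, x, hx, rfl⟩ := hcon a
    have hp0 : (0 : ℤ) < p := by exact_mod_cast hp.pos
    refine ⟨(k % p).toNat, ?_, ?_⟩
    · have := Int.emod_lt_of_pos k hp0
      have := Int.emod_nonneg k hp0.ne'
      simp only [Finset.coe_range, Set.mem_Iio]
      omega
    · change p • P ^ (k % p).toNat = p • (P ^ k * x)
      rw [nsmul_mul_of_mem_mulTorsion _ hx]
      conv_rhs => rw [← Int.emod_add_mul_ediv k p, zpow_add, zpow_mul, zpow_natCast]
      rw [nsmul_mul_of_mem_mulTorsion _ ((mulTorsion A p).zpow_mem hPp _), ← zpow_natCast,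
        Int.toNat_of_nonneg (Int.emod_nonneg k hp0.ne')]
  have hle := (Set.ncard_le_ncard hsub (Finset.finite_toSet _ |>.image _)).trans
    (Set.ncard_image_le (Finset.finite_toSet _))
  rw [Set.ncard_coe_finset, Finset.card_range] at hle
  have hi := index_ker_nsmul hcard htor
  rw [AddSubgroup.index_ker] at hi
  change Nat.card (nsmulAddMonoidHom (α := A) p).range ≤ p at hle
  rw [hi] at hle
  nlinarith

end Brace

theorem ZMod.nsmul_eq_zero_iff_exists {p : ℕ} (hp : p.Prime) (x : ZMod (p ^ 2)) :
    p • x = 0 ↔ ∃ y, x = p • y := by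
  have : NeZero (p ^ 2) := ⟨pow_ne_zero _ hp.ne_zero⟩
  have hp2 : ((p : ZMod (p ^ 2)) * p) = 0 := by
    rw [← pow_two, ← Nat.cast_pow, ZMod.natCast_self]
  constructor
  · intro h
    rw [← ZMod.natCast_zmod_val x, nsmul_eq_mul, ← Nat.cast_mul, ZMod.natCast_eq_zero_iff] at h
    obtain ⟨c, hc⟩ := Nat.dvd_of_mul_dvd_mul_left hp.pos ((pow_two p).symm.dvd.trans h)
    exact ⟨c, by rw [nsmul_eq_mul, ← Nat.cast_mul, ← hc, ZMod.natCast_zmod_val]⟩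
  · rintro ⟨y, rfl⟩
    rw [nsmul_eq_mul, nsmul_eq_mul, ← mul_assoc, hp2, zero_mul]

theorem nsmul_eq_zero_iff_exists_of_addEquiv {p : ℕ} (hp : p.Prime) {A : Type*} [AddCommGroup A]
    (e : A ≃+ ZMod (p ^ 2) × ZMod (p ^ 2)) (x : A) : p • x = 0 ↔ ∃ y, x = p • y := by
  rw [← e.map_eq_zero_iff, map_nsmul, Prod.ext_iff]
  change p • (e x).1 = 0 ∧ p • (e x).2 = 0 ↔ _
  rw [ZMod.nsmul_eq_zero_iff_exists hp, ZMod.nsmul_eq_zero_iff_exists hp]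
  constructor
  · rintro ⟨⟨y, hy⟩, z, hz⟩
    exact ⟨e.symm (y, z), e.injective (by rw [map_nsmul, e.apply_symm_apply]; exact Prod.ext hy hz)⟩
  · rintro ⟨y, rfl⟩
    rw [map_nsmul]
    exact ⟨⟨_, rfl⟩, _, rfl⟩

theorem index_ker_nsmul_sq_of_addEquiv {p : ℕ} (hp : p.Prime) {A : Type*} [AddCommGroup A]
    (e : A ≃+ ZMod p × ZMod (p ^ 3)) : (nsmulAddMonoidHom (α := A) (p ^ 2)).ker.index = p := by
  have : NeZero (p ^ 3) := ⟨pow_ne_zero _ hp.ne_zero⟩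
  have hr : (nsmulAddMonoidHom (α := A) (p ^ 2)).range =
      AddSubgroup.zmultiples (e.symm (0, ((p ^ 2 : ℕ) : ZMod (p ^ 3)))) := by
    ext x
    rw [AddMonoidHom.mem_range, AddSubgroup.mem_zmultiples_iff]
    constructor
    · rintro ⟨y, rfl⟩
      refine ⟨(e y).2.val, e.injective ?_⟩
      rw [nsmulAddMonoidHom_apply, map_zsmul, map_nsmul, e.apply_symm_apply]
      refine Prod.ext ?_ ?_
      · simp
      · simp [mul_comm]
    · rintro ⟨k, rfl⟩
      refine ⟨e.symm (0, k), e.injective ?_⟩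
      rw [nsmulAddMonoidHom_apply, map_zsmul, map_nsmul, e.apply_symm_apply, e.apply_symm_apply]
      refine Prod.ext ?_ ?_
      · simp
      · simp [mul_comm]
  rw [AddSubgroup.index_ker, hr, Nat.card_zmultiples, AddEquiv.addOrderOf_eq]
  rw [Prod.addOrderOf_mk, addOrderOf_zero, Nat.lcm_one_left,
    ZMod.addOrderOf_coe _ (NeZero.ne _), Nat.gcd_eq_right (pow_dvd_pow p (by norm_num)),
    Nat.pow_div (by norm_num) hp.pos, pow_one]

/-- under Setup (T), P ∗ (p^m·a) = 0 for all a ∈ A. -/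
theorem setupT_star_pm_smul (p m i : ℕ) (A : Type*) [Brace A]
    (P : A) (Q : Fin i → A) (h : SetupT p m i A P Q) :
    ∀ a : A, Brace.bstar P ((p ^ m) • a) = 0 := by
  obtain ⟨⟨e⟩, rfl⟩ | ⟨⟨e⟩, rfl⟩ := h.hadd
  · exact Brace.nsmul_bstar_eq_zero_of_index h.hp h.hcard (index_ker_nsmul_sq_of_addEquiv h.hp e) P
  · exfalso
    have htor := nsmul_eq_zero_iff_exists_of_addEquiv h.hp e
    have hQ : ∀ j, Q j ∈ Brace.mulTorsion A p := fun j => by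
      refine Brace.nsmul_eq_zero_of_pow_eq_one h.hp h.hp5 h.hcard htor ?_
      rw [← orderOf_dvd_iff_pow_eq_one]
      obtain ⟨k, -, hk⟩ := (Nat.dvd_prime_pow h.hp).1 (h.hcard ▸ orderOf_dvd_natCard (Q j))
      have hle := h.hord j
      rw [hk] at hle ⊢
      simpa using pow_dvd_pow p ((Nat.pow_le_pow_iff_right h.hp.one_lt).1 hle)
    obtain ⟨a, ha⟩ := Brace.exists_forall_ne_zpow_mul h.hp h.hp5 h.hcard htor P
    obtain ⟨k, f, hkf⟩ := h.hdecomp a (Equiv.refl _)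
    refine ha k _ (Subgroup.list_prod_mem _ fun x hx => ?_) hkf
    obtain ⟨t, rfl⟩ := (List.mem_ofFn' _ _).1 hx
    exact Subgroup.zpow_mem _ (hQ _) _
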